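/- arXiv:2109.11034 — 3 statements merged into one kernel-verified Lean document; each statement's English description precedes it below -/
import Mathlib

section
/- Let N ≥ 1, 1 ≤ K ≤ N, and let w : {1,…,N} → ℝ be strictly positive weights. Define Z(n,k) := Σ_{S ⊆ {1,…,n}, |S| = k} ∏_{i∈S} w_i (with Z(n,0) = 1 and Z(n,k)=0 for k > n). Fix a subset Y ⊆ {1,…,N} with |Y| = K, and for each n ∈ {1,…,N} let k_n := |Y ∩ {1,…,n}|. Then the product of the step probabilities of the sequential conditional Poisson sampling algorithm, ∏_{n=1}^{N} f(n), where f(n) = w_n · Z(n-1, k_n - 1)/Z(n, k_n) if n ∈ Y and f(n) = Z(n-1, k_n)/Z(n, k_n) if n ∉ Y, equals ∏_{i∈Y} w_i / Z(N,K). In other words, the sequential sampling algorithm produces each size-K subset Y with exactly its conditional Poisson probability. -/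
open Finset

/-- The elementary-symmetric-polynomial-type partial sum
`Z w n k = ∑_{S ⊆ {1,…,n}, |S| = k} ∏_{i ∈ S} w i`. -/
noncomputable def cpZ (w : ℕ → ℝ) (n k : ℕ) : ℝ :=
  ∑ S ∈ (Finset.Icc 1 n).powersetCard k, ∏ i ∈ S, w i

/-- `cpZ w n k` is positive when the weights on `{1,…,n}` are and `k ≤ n`. -/
theorem cpZ_pos {w : ℕ → ℝ} {n k : ℕ} (hw : ∀ i ∈ Finset.Icc 1 n, 0 < w i) (hk : k ≤ n) :
    0 < cpZ w n k := by
  refine Finset.sum_pos (fun S hS => Finset.prod_pos fun i hi => ?_) ?_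
  · exact hw i ((Finset.mem_powersetCard.mp hS).1 hi)
  · exact Finset.powersetCard_nonempty.mpr (by simpa using hk)

theorem card_inter_Icc_one_le (Y : Finset ℕ) (n : ℕ) : (Y ∩ Finset.Icc 1 n).card ≤ n := by
  simpa using Finset.card_le_card (Finset.inter_subset_right (s₁ := Y) (s₂ := Finset.Icc 1 n))

/-- The step probabilities of the sequential algorithm telescope. -/
theorem prod_sequential_step (w : ℕ → ℝ) (Y : Finset ℕ) (m : ℕ)
    (hw : ∀ i ∈ Finset.Icc 1 m, 0 < w i) :
    (∏ n ∈ Finset.Icc 1 m,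
        if n ∈ Y then
          w n * cpZ w (n - 1) ((Y ∩ Finset.Icc 1 n).card - 1) / cpZ w n ((Y ∩ Finset.Icc 1 n).card)
        else
          cpZ w (n - 1) ((Y ∩ Finset.Icc 1 n).card) / cpZ w n ((Y ∩ Finset.Icc 1 n).card))
      = (∏ i ∈ Y ∩ Finset.Icc 1 m, w i) / cpZ w m ((Y ∩ Finset.Icc 1 m).card) := by
  induction m with
  | zero => simp [cpZ]
  | succ m ih =>
    have hw' : ∀ i ∈ Finset.Icc 1 m, 0 < w i := fun i hi =>
      hw i (Finset.Icc_subset_Icc_right m.le_succ hi)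
    have hpos := (cpZ_pos hw' (card_inter_Icc_one_le Y m)).ne'
    have hIcc : Finset.Icc 1 (m + 1) = insert (m + 1) (Finset.Icc 1 m) :=
      (Finset.insert_Icc_right_eq_Icc_add_one (by omega)).symm
    rw [Finset.prod_Icc_succ_top (by omega), ih hw', Nat.add_sub_cancel]
    by_cases hmem : m + 1 ∈ Y
    · have hinter : Y ∩ Finset.Icc 1 (m + 1) = insert (m + 1) (Y ∩ Finset.Icc 1 m) := by
        rw [hIcc, Finset.inter_insert_of_mem hmem]
      have hnot : m + 1 ∉ Y ∩ Finset.Icc 1 m := by simp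
      rw [if_pos hmem, hinter, Finset.prod_insert hnot, Finset.card_insert_of_notMem hnot,
        Nat.add_sub_cancel]
      field_simp
    · have hinter : Y ∩ Finset.Icc 1 (m + 1) = Y ∩ Finset.Icc 1 m := by
        rw [hIcc, Finset.inter_insert_of_notMem hmem]
      rw [if_neg hmem, hinter]
      field_simp

/-- The sequential conditional Poisson sampling algorithm produces each size-`K`
subset `Y` with exactly its conditional Poisson probability. -/
theorem sequential_cp_sampling_correct (N K : ℕ) (hN : 1 ≤ N) (hK1 : 1 ≤ K) (hKN : K ≤ N)
    (w : ℕ → ℝ) (hw : ∀ i ∈ Finset.Icc 1 N, 0 < w i)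
    (Y : Finset ℕ) (hY : Y ⊆ Finset.Icc 1 N) (hYcard : Y.card = K) :
    (∏ n ∈ Finset.Icc 1 N,
        if n ∈ Y then
          w n * cpZ w (n - 1) ((Y ∩ Finset.Icc 1 n).card - 1) / cpZ w n ((Y ∩ Finset.Icc 1 n).card)
        else
          cpZ w (n - 1) ((Y ∩ Finset.Icc 1 n).card) / cpZ w n ((Y ∩ Finset.Icc 1 n).card))
      = (∏ i ∈ Y, w i) / cpZ w N K := by
  rw [prod_sequential_step w Y N hw, Finset.inter_eq_left.mpr hY, hYcard]
end

section
/- Let N ≥ 1, 1 ≤ K ≤ N, and let w : {1,…,N} → ℝ be strictly positive weights. Suppose S* ⊆ {1,…,N} with |S*| = K is the strict maximizer of the weight product, i.e., for every subset S of size K with S ≠ S*, ∏_{i∈S} w_i < ∏_{i∈S*} w_i. For τ > 0 let Q_τ denote the conditional Poisson distribution of size K with annealed weights w_i^{1/τ}, i.e., Q_τ(Y) = ∏_{i∈Y} w_i^{1/τ} / Σ_{|S|=K} ∏_{i∈S} w_i^{1/τ} for |Y| = K. Then Q_τ(S*) → 1 as τ → 0⁺; i.e., annealed conditional Poisson sampling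 recovers the top-K (beam search) set in the zero-temperature limit. -/
open Finset Filter

/-- Softmax concentration: if `p a` strictly dominates the other positive masses on `s`, then the
normalized power `p a ^ x / ∑ i ∈ s, p i ^ x` tends to `1` as `x → ∞`. -/
theorem tendsto_rpow_div_sum_rpow_atTop {ι : Type*} {s : Finset ι} {p : ι → ℝ} {a : ι}
    (ha : a ∈ s) (hp : ∀ i ∈ s, 0 < p i) (hmax : ∀ i ∈ s, i ≠ a → p i < p a) :
    Tendsto (fun x : ℝ => p a ^ x / ∑ i ∈ s, p i ^ x) atTop (nhds 1) := by
  classical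
  have hpa := hp a ha
  have hterm : ∀ i ∈ s, Tendsto (fun x : ℝ => (p i / p a) ^ x) atTop
      (nhds (if i = a then 1 else 0)) := by
    intro i hi
    split_ifs with h
    · subst h
      simp [div_self hpa.ne']
    · exact tendsto_rpow_atTop_of_base_lt_one _
        (by linarith [div_pos (hp i hi) hpa]) ((div_lt_one hpa).2 (hmax i hi h))
  have hsum := (tendsto_finsetSum s hterm).inv₀ (by simp [ha])
  simp only [Finset.sum_ite_eq', ha, if_true, inv_one] at hsum
  refine hsum.congr fun x => ?_
  rw [Finset.sum_congr rfl fun i hi => Real.div_rpow (hp i hi).le hpa.le x,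
    ← Finset.sum_div, inv_div]

/-- Annealed conditional Poisson sampling recovers the top-`K` (beam search)
set in the zero-temperature limit. -/
theorem annealed_cp_recovers_beam_search (N K : ℕ) (hN : 1 ≤ N) (hK1 : 1 ≤ K) (hKN : K ≤ N)
    (w : ℕ → ℝ) (hw : ∀ i ∈ Finset.Icc 1 N, 0 < w i)
    (Sstar : Finset ℕ) (hSstar : Sstar ∈ (Finset.Icc 1 N).powersetCard K)
    (hmax : ∀ S ∈ (Finset.Icc 1 N).powersetCard K, S ≠ Sstar →
      (∏ i ∈ S, w i) < ∏ i ∈ Sstar, w i) :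
    Filter.Tendsto
      (fun τ : ℝ =>
        (∏ i ∈ Sstar, w i ^ (1 / τ)) /
          ∑ S ∈ (Finset.Icc 1 N).powersetCard K, ∏ i ∈ S, w i ^ (1 / τ))
      (nhdsWithin 0 (Set.Ioi 0)) (nhds 1) := by
  have hpos : ∀ S ∈ (Finset.Icc 1 N).powersetCard K, ∀ i ∈ S, 0 < w i := fun S hS i hi =>
    hw i ((Finset.mem_powersetCard.1 hS).1 hi)
  have hlim := (tendsto_rpow_div_sum_rpow_atTop hSstar
    (fun S hS => Finset.prod_pos (hpos S hS)) hmax).comp (tendsto_inv_nhdsGT_zero (𝕜 := ℝ))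
  have hprod : ∀ S ∈ (Finset.Icc 1 N).powersetCard K, ∀ x : ℝ,
      (∏ i ∈ S, w i) ^ x = ∏ i ∈ S, w i ^ x := fun S hS x =>
    (Real.finsetProd_rpow S w (fun i hi => (hpos S hS i hi).le) x).symm
  refine hlim.congr fun τ => ?_
  simp only [Function.comp_apply, one_div]
  rw [hprod Sstar hSstar, Finset.sum_congr rfl fun S hS => hprod S hS τ⁻¹]
end

section
/- Let S be a finite nonempty type, T ≥ 1, and s_0 ∈ S an initial state. For each t ∈ {1,…,T} let Q_t : S × S → ℝ be nonnegative with Σ_{s'} Q_t(s,s') = 1 for all s, and let A_t ⊆ S be events. Define π_t(s) := Σ_{s' ∈ A_t} Q_t(s,s'), assumed strictly positive for all s, and Q̃_t(s,s') := Q_t(s,s')·1{s' ∈ A_t}/π_t(s). Let Π := Σ over trajectories with s_t ∈ A_t for all t of ∏_{t=1}^T Q_t(s_{t-1},s_t), and assume Π > 0. Suppose there is r ≥ 1 such that for every trajectory (s_1,…,s_T) ∈ S^T we have ∏_{t=1}^T π_t(s_{t-1}) ≤ r·Π. Then the variance of the single-sample importance-sampling estimator W(s_1,…,s_T) := ∏_{t=1}^T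 π_t(s_{t-1}) under the proposal chain is bounded: Σ over all trajectories of (∏_{t=1}^T Q̃_t(s_{t-1},s_t)) · W(s_1,…,s_T)² − Π² ≤ (r − 1)·Π². -/
open Finset

noncomputable section
open scoped Classical

/-- The trajectory `s_0, s_1, …, s_T` determined by an initial state `s0` and a
tuple `g : Fin T → S` of subsequent states: `traj s0 g t = s_t` (and `s0` for
`t = 0` or `t > T`). -/
def traj {S : Type*} (s0 : S) {T : ℕ} (g : Fin T → S) (t : ℕ) : S :=
  if h : 1 ≤ t ∧ t ≤ T then g ⟨t - 1, by omega⟩ else s0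

/-- Variance bound for the single-sample importance-sampling estimator of the
total inclusion probability (Proposition 3(ii), abstract Markov-chain form). -/
theorem is_estimator_variance_bound
    {S : Type*} [Fintype S] [Nonempty S] [DecidableEq S] (T : ℕ) (hT : 1 ≤ T) (s0 : S)
    (Q : ℕ → S → S → ℝ)
    (hQnonneg : ∀ t ∈ Finset.Icc 1 T, ∀ s s' : S, 0 ≤ Q t s s')
    (hQsum : ∀ t ∈ Finset.Icc 1 T, ∀ s : S, ∑ s' : S, Q t s s' = 1)
    (A : ℕ → Finset S)
    (π : ℕ → S → ℝ) (hπ : ∀ t s, π t s = ∑ s' ∈ A t, Q t s s')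
    (hπpos : ∀ t ∈ Finset.Icc 1 T, ∀ s : S, 0 < π t s)
    (Qtilde : ℕ → S → S → ℝ)
    (hQtilde : ∀ t s s', Qtilde t s s' = Q t s s' * (if s' ∈ A t then 1 else 0) / π t s)
    (Ptot : ℝ)
    (hPtot : Ptot = ∑ g ∈ (Finset.univ : Finset (Fin T → S)).filter
        (fun g => ∀ t ∈ Finset.Icc 1 T, traj s0 g t ∈ A t),
      ∏ t ∈ Finset.Icc 1 T, Q t (traj s0 g (t - 1)) (traj s0 g t))
    (hPtotpos : 0 < Ptot) (r : ℝ) (hr : 1 ≤ r)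
    (hbound : ∀ g : Fin T → S,
      (∏ t ∈ Finset.Icc 1 T, π t (traj s0 g (t - 1))) ≤ r * Ptot) :
    (∑ g : Fin T → S,
        (∏ t ∈ Finset.Icc 1 T, Qtilde t (traj s0 g (t - 1)) (traj s0 g t))
          * (∏ t ∈ Finset.Icc 1 T, π t (traj s0 g (t - 1))) ^ 2)
        - Ptot ^ 2
      ≤ (r - 1) * Ptot ^ 2 := by
  have hfactor (g : Fin T → S) :
      (∏ t ∈ Finset.Icc 1 T, Qtilde t (traj s0 g (t - 1)) (traj s0 g t))
          * ∏ t ∈ Finset.Icc 1 T, π t (traj s0 g (t - 1))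
        = if ∀ t ∈ Finset.Icc 1 T, traj s0 g t ∈ A t then
            ∏ t ∈ Finset.Icc 1 T, Q t (traj s0 g (t - 1)) (traj s0 g t) else 0 := by
    rw [← Finset.prod_ite_zero, ← Finset.prod_mul_distrib]
    refine Finset.prod_congr rfl fun t ht => ?_
    rw [hQtilde, div_mul_cancel₀ _ (hπpos t ht _).ne', mul_ite, mul_one, mul_zero]
  have hnonneg (g : Fin T → S) :
      0 ≤ if ∀ t ∈ Finset.Icc 1 T, traj s0 g t ∈ A t then
            ∏ t ∈ Finset.Icc 1 T, Q t (traj s0 g (t - 1)) (traj s0 g t) else 0 := by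
    split_ifs
    · exact Finset.prod_nonneg fun t ht => hQnonneg t ht _ _
    · exact le_rfl
  have hsecond :
      ∑ g : Fin T → S,
        (∏ t ∈ Finset.Icc 1 T, Qtilde t (traj s0 g (t - 1)) (traj s0 g t))
          * (∏ t ∈ Finset.Icc 1 T, π t (traj s0 g (t - 1))) ^ 2 ≤ Ptot * (r * Ptot) := by
    conv_rhs => enter [1]; rw [hPtot, Finset.sum_filter]
    rw [Finset.sum_mul]
    refine Finset.sum_le_sum fun g _ => ?_
    rw [sq, ← mul_assoc, hfactor]
    convert mul_le_mul_of_nonneg_left (hbound g) (hnonneg g)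
  linarith
end
end
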